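/- Suppose the support of P_X is contained in B_M for some constant M > 0 and λ₁,…,λ_d > 0. Let {P_θ : θ ∈ Θ} be a family of Borel probability measures on ℝ^d with finite first moments, and let θ̂ = θ̂(X^(1),…,X^(n)) be a measurable selection satisfying D(P̂ⁿ, P_θ̂) = inf_{θ∈Θ} D(P̂ⁿ, P_θ) almost surely. Then there exists a deterministic constant C depending only on M such that for each j ∈ {1,…,d}, E[W₁((p_j)_*P_X, (p_j)_*P_θ̂)] ≤ λ_j^{−1} E[inf_{θ∈Θ} D(P̂ⁿ, P_θ)] + C n^{−1/2}. -/

import Mathlib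

open MeasureTheory Set
open scoped ENNReal

/-- The 1-Wasserstein distance between two measures, defined via the primal
(optimal transport) formulation: the infimum of `∫ ‖x - y‖ dπ` over all
couplings `π` of `μ` and `ν`. -/
noncomputable def W1 {E : Type*} [MeasurableSpace E] [NormedAddCommGroup E]
    (μ ν : Measure E) : ℝ :=
  sInf {c : ℝ | ∃ π : Measure (E × E), IsProbabilityMeasure π ∧
    π.map Prod.fst = μ ∧ π.map Prod.snd = ν ∧ c = ∫ p, ‖p.1 - p.2‖ ∂π}

/-- A measure has a finite first moment. -/
def FiniteFirstMoment {E : Type*} [MeasurableSpace E] [NormedAddCommGroup E]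
    (μ : Measure E) : Prop :=
  HasFiniteIntegral (fun x => ‖x‖) μ

/-- The marginally-penalized Wasserstein (MPW) distance with weights `lam`. -/
noncomputable def MPW {d : ℕ} (lam : Fin d → ℝ)
    (μ ν : Measure (EuclideanSpace ℝ (Fin d))) : ℝ :=
  W1 μ ν + ∑ j : Fin d, lam j * W1 (μ.map (fun x => x j)) (ν.map (fun x => x j))

/-- The empirical measure of a sample `x : Fin n → E`. -/
noncomputable def empMeasure {E : Type*} [MeasurableSpace E] {n : ℕ}
    (x : Fin n → E) : Measure E :=
  (n : ℝ≥0∞)⁻¹ • ∑ i : Fin n, Measure.dirac (x i)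

open ProbabilityTheory

/-- A probability measure on the product with prescribed marginals. -/
structure IsCoupling {E : Type*} [MeasurableSpace E] (π : Measure (E × E)) (μ ν : Measure E) :
    Prop where
  prob : IsProbabilityMeasure π
  map_fst : π.map Prod.fst = μ
  map_snd : π.map Prod.snd = ν

/-- The gluing lemma: two measures on products sharing a marginal are the two-dimensional marginals
of a single measure. -/
theorem exists_gluing {α β δ : Type*} [MeasurableSpace α] [MeasurableSpace β] [MeasurableSpace δ]
    [StandardBorelSpace α] [Nonempty α] [StandardBorelSpace δ] [Nonempty δ]
    (π₁ : Measure (α × β)) (π₂ : Measure (β × δ)) [IsFiniteMeasure π₁] [IsProbabilityMeasure π₂]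
    (h : π₁.map Prod.snd = π₂.map Prod.fst) :
    ∃ γ : Measure (β × α × δ), IsProbabilityMeasure γ ∧
      γ.map (fun z => (z.2.1, z.1)) = π₁ ∧ γ.map (fun z => (z.1, z.2.2)) = π₂ := by
  have hs : (π₁.map Prod.swap).fst = π₂.fst := by
    rw [Measure.fst, Measure.map_map measurable_fst measurable_swap]
    exact h
  have h₁ : π₂.fst ⊗ₘ (π₁.map Prod.swap).condKernel = π₁.map Prod.swap := by
    rw [← hs]; exact Measure.disintegrate _ _
  have h₂ : π₂.fst ⊗ₘ π₂.condKernel = π₂ := Measure.disintegrate _ _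
  refine ⟨π₂.fst ⊗ₘ ((π₁.map Prod.swap).condKernel ×ₖ π₂.condKernel), inferInstance, ?_, ?_⟩
  · have h₃ := Measure.compProd_map (μ := π₂.fst)
      (κ := (π₁.map Prod.swap).condKernel ×ₖ π₂.condKernel) measurable_fst
    rw [← Kernel.fst_eq, Kernel.fst_prod, h₁] at h₃
    have h₄ := congrArg (Measure.map Prod.swap) h₃
    rw [Measure.map_map measurable_swap measurable_swap, Prod.swap_swap_eq, Measure.map_id,
      Measure.map_map measurable_swap (by fun_prop)] at h₄
    exact h₄.symm
  · have h₃ := Measure.compProd_map (μ := π₂.fst)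
      (κ := (π₁.map Prod.swap).condKernel ×ₖ π₂.condKernel) measurable_snd
    rw [← Kernel.snd_eq, Kernel.snd_prod, h₂] at h₃
    exact h₃.symm

section W1

variable {E : Type*} [MeasurableSpace E] [NormedAddCommGroup E]

theorem W1_set_bddBelow (μ ν : Measure E) :
    BddBelow {c : ℝ | ∃ π : Measure (E × E), IsProbabilityMeasure π ∧
      π.map Prod.fst = μ ∧ π.map Prod.snd = ν ∧ c = ∫ p, ‖p.1 - p.2‖ ∂π} := by
  refine ⟨0, ?_⟩
  rintro _ ⟨π, -, -, -, rfl⟩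
  positivity

theorem W1_nonneg (μ ν : Measure E) : 0 ≤ W1 μ ν := by
  refine Real.sInf_nonneg ?_
  rintro _ ⟨π, -, -, -, rfl⟩
  positivity

theorem IsCoupling.W1_le {π : Measure (E × E)} {μ ν : Measure E} (h : IsCoupling π μ ν) :
    W1 μ ν ≤ ∫ p, ‖p.1 - p.2‖ ∂π :=
  csInf_le (W1_set_bddBelow μ ν) ⟨π, h.prob, h.map_fst, h.map_snd, rfl⟩

theorem exists_isCoupling_lt (μ ν : Measure E) [IsProbabilityMeasure μ] [IsProbabilityMeasure ν]
    {ε : ℝ} (hε : 0 < ε) :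
    ∃ π, IsCoupling π μ ν ∧ ∫ p, ‖p.1 - p.2‖ ∂π < W1 μ ν + ε := by
  have hne : {c : ℝ | ∃ π : Measure (E × E), IsProbabilityMeasure π ∧
      π.map Prod.fst = μ ∧ π.map Prod.snd = ν ∧ c = ∫ p, ‖p.1 - p.2‖ ∂π}.Nonempty :=
    ⟨_, μ.prod ν, inferInstance, by simp, by simp, rfl⟩
  obtain ⟨_, ⟨π, h, h₁, h₂, rfl⟩, hlt⟩ := exists_lt_of_csInf_lt hne (lt_add_of_pos_right _ hε)
  exact ⟨π, ⟨h, h₁, h₂⟩, hlt⟩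

variable [BorelSpace E] [SecondCountableTopology E]

theorem FiniteFirstMoment.integrable {μ : Measure E} (h : FiniteFirstMoment μ) :
    Integrable (fun x => x) μ :=
  (integrable_norm_iff (by fun_prop)).1 ⟨by fun_prop, h⟩

theorem IsCoupling.integrable_sub {π : Measure (E × E)} {μ ν : Measure E} (h : IsCoupling π μ ν)
    (hμ : FiniteFirstMoment μ) (hν : FiniteFirstMoment ν) :
    Integrable (fun p : E × E => p.1 - p.2) π := by
  have h₁ : Integrable (fun p : E × E => p.1) π := by
    have := hμ.integrable
    rw [← h.map_fst] at this
    exact this.comp_measurable measurable_fst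
  have h₂ : Integrable (fun p : E × E => p.2) π := by
    have := hν.integrable
    rw [← h.map_snd] at this
    exact this.comp_measurable measurable_snd
  exact h₁.sub h₂

theorem W1_triangle [CompleteSpace E] {μ ν ρ : Measure E} [IsProbabilityMeasure μ]
    [IsProbabilityMeasure ν] [IsProbabilityMeasure ρ] (hμ : FiniteFirstMoment μ)
    (hν : FiniteFirstMoment ν) (hρ : FiniteFirstMoment ρ) :
    W1 μ ρ ≤ W1 μ ν + W1 ν ρ := by
  refine le_of_forall_pos_le_add fun ε hε => ?_
  obtain ⟨π₁, h₁, hlt₁⟩ := exists_isCoupling_lt μ ν (half_pos hε)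
  obtain ⟨π₂, h₂, hlt₂⟩ := exists_isCoupling_lt ν ρ (half_pos hε)
  have := h₁.prob
  have := h₂.prob
  obtain ⟨γ, hγ, hγ₁, hγ₂⟩ := exists_gluing π₁ π₂ (h₁.map_snd.trans h₂.map_fst.symm)
  have m₁ : Measurable (fun z : E × E × E => (z.2.1, z.1)) := by fun_prop
  have m₂ : Measurable (fun z : E × E × E => (z.1, z.2.2)) := by fun_prop
  have m₃ : Measurable (fun z : E × E × E => (z.2.1, z.2.2)) := by fun_prop
  have hc : IsCoupling (γ.map fun z => (z.2.1, z.2.2)) μ ρ := by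
    refine ⟨Measure.isProbabilityMeasure_map m₃.aemeasurable, ?_, ?_⟩
    · rw [← h₁.map_fst, ← hγ₁, Measure.map_map measurable_fst m₃,
        Measure.map_map measurable_fst m₁]
      rfl
    · rw [← h₂.map_snd, ← hγ₂, Measure.map_map measurable_snd m₃,
        Measure.map_map measurable_snd m₂]
      rfl
  have hn : StronglyMeasurable (fun p : E × E => ‖p.1 - p.2‖) :=
    Measurable.stronglyMeasurable (by fun_prop)
  have i₁ : Integrable (fun z : E × E × E => ‖z.2.1 - z.1‖) γ := by
    have := (h₁.integrable_sub hμ hν).norm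
    rw [← hγ₁] at this
    exact this.comp_measurable m₁
  have i₂ : Integrable (fun z : E × E × E => ‖z.1 - z.2.2‖) γ := by
    have := (h₂.integrable_sub hν hρ).norm
    rw [← hγ₂] at this
    exact this.comp_measurable m₂
  have e₁ : ∫ p, ‖p.1 - p.2‖ ∂π₁ = ∫ z, ‖z.2.1 - z.1‖ ∂γ := by
    rw [← hγ₁, integral_map m₁.aemeasurable hn.aestronglyMeasurable]
  have e₂ : ∫ p, ‖p.1 - p.2‖ ∂π₂ = ∫ z, ‖z.1 - z.2.2‖ ∂γ := by
    rw [← hγ₂, integral_map m₂.aemeasurable hn.aestronglyMeasurable]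
  have hle := hc.W1_le
  rw [integral_map m₃.aemeasurable hn.aestronglyMeasurable] at hle
  have : ∫ z : E × E × E, ‖z.2.1 - z.2.2‖ ∂γ ≤
      ∫ z, ‖z.2.1 - z.1‖ ∂γ + ∫ z, ‖z.1 - z.2.2‖ ∂γ := by
    rw [← integral_add i₁ i₂]
    refine integral_mono_of_nonneg (.of_forall fun _ => by positivity) (i₁.add i₂)
      (.of_forall fun z => ?_)
    exact norm_sub_le_norm_sub_add_norm_sub _ _ _
  linarith

end W1

section empMeasure

theorem isProbabilityMeasure_empMeasure {E : Type*} [MeasurableSpace E] {n : ℕ} (hn : 0 < n)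
    (x : Fin n → E) : IsProbabilityMeasure (empMeasure x) := by
  constructor
  simp [empMeasure, ENNReal.inv_mul_cancel, hn.ne']

theorem map_empMeasure {E F : Type*} [MeasurableSpace E] [MeasurableSpace F] {n : ℕ}
    (x : Fin n → E) {f : E → F} (hf : Measurable f) :
    (empMeasure x).map f = empMeasure (fun i => f (x i)) := by
  simp [empMeasure, Measure.map_finset_sum' hf.aemeasurable, Measure.map_dirac' hf]

theorem lintegral_empMeasure {E : Type*} [MeasurableSpace E] {n : ℕ} (x : Fin n → E)
    {f : E → ℝ≥0∞} (hf : Measurable f) :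
    ∫⁻ y, f y ∂(empMeasure x) = (n : ℝ≥0∞)⁻¹ * ∑ i, f (x i) := by
  simp [empMeasure, lintegral_dirac' _ hf]

theorem integral_empMeasure {E : Type*} [MeasurableSpace E] {n : ℕ} (x : Fin n → E)
    {f : E → ℝ} (hf : StronglyMeasurable f) :
    ∫ y, f y ∂(empMeasure x) = (n : ℝ)⁻¹ * ∑ i, f (x i) := by
  rw [empMeasure, integral_smul_measure, integral_finsetSum_measure]
  · simp [integral_dirac' _ _ hf]
  · intro i _
    exact integrable_dirac' hf (by simp)

theorem finiteFirstMoment_empMeasure {E : Type*} [MeasurableSpace E] [NormedAddCommGroup E]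
    [BorelSpace E] {n : ℕ} (hn : 0 < n) (x : Fin n → E) : FiniteFirstMoment (empMeasure x) := by
  rw [FiniteFirstMoment, HasFiniteIntegral, lintegral_empMeasure x (by fun_prop)]
  exact ENNReal.mul_lt_top (by simp [hn]) (by simp)

theorem W1_empMeasure_le {E : Type*} [MeasurableSpace E] [NormedAddCommGroup E] [BorelSpace E]
    [SecondCountableTopology E] {n : ℕ} (hn : 0 < n) (x y : Fin n → E) :
    W1 (empMeasure x) (empMeasure y) ≤ (n : ℝ)⁻¹ * ∑ i, ‖x i - y i‖ := by
  have hc : IsCoupling (empMeasure fun i => (x i, y i)) (empMeasure x) (empMeasure y) :=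
    ⟨isProbabilityMeasure_empMeasure hn _, map_empMeasure _ measurable_fst,
      map_empMeasure _ measurable_snd⟩
  refine hc.W1_le.trans_eq ?_
  rw [integral_empMeasure]
  exact Measurable.stronglyMeasurable (by fun_prop)

theorem W1_empMeasure_le_of_forall_norm_sub_le {E : Type*} [MeasurableSpace E]
    [NormedAddCommGroup E] [BorelSpace E] [SecondCountableTopology E] {n : ℕ} (hn : 0 < n)
    {x y : Fin n → E} {r : ℝ} (h : ∀ i, ‖x i - y i‖ ≤ r) :
    W1 (empMeasure x) (empMeasure y) ≤ r := by
  have hn' : (0 : ℝ) < n := by exact_mod_cast hn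
  refine (W1_empMeasure_le hn x y).trans ?_
  rw [inv_mul_le_iff₀ hn']
  refine (Finset.sum_le_sum fun i _ => h i).trans_eq ?_
  simp

end empMeasure

section quantile

/-- The quantile function of a real probability measure. -/
noncomputable def quantile (μ : Measure ℝ) (u : ℝ) : ℝ :=
  sInf {t | u ≤ cdf μ t}

theorem quantile_le_iff {μ : Measure ℝ} {u t : ℝ} (hu : u ∈ Ioo (0 : ℝ) 1) :
    quantile μ u ≤ t ↔ u ≤ cdf μ t := by
  have hne : {t | u ≤ cdf μ t}.Nonempty :=
    (((tendsto_cdf_atTop μ).eventually (lt_mem_nhds hu.2)).mono fun _ h => le_of_lt h).exists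
  have hbdd : BddBelow {t | u ≤ cdf μ t} := by
    obtain ⟨a, ha⟩ := ((tendsto_cdf_atBot μ).eventually (gt_mem_nhds hu.1)).exists
    exact ⟨a, fun t ht => le_of_lt ((monotone_cdf μ).reflect_lt (ha.trans_le ht))⟩
  refine ⟨fun h => ?_, fun h => csInf_le hbdd h⟩
  have hright : Filter.Tendsto (cdf μ) (nhdsWithin t (Ioi t)) (nhds (cdf μ t)) :=
    ((cdf μ).right_continuous t).mono_left (nhdsWithin_mono _ Ioi_subset_Ici_self)
  refine ge_of_tendsto hright ?_
  filter_upwards [self_mem_nhdsWithin] with s hs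
  obtain ⟨r, hr, hrs⟩ := exists_lt_of_csInf_lt hne (lt_of_le_of_lt h hs)
  exact le_trans hr (monotone_cdf μ hrs.le)

theorem aemeasurable_quantile (μ : Measure ℝ) :
    AEMeasurable (quantile μ) (volume.restrict (Ioo 0 1)) := by
  refine aemeasurable_restrict_of_monotoneOn measurableSet_Ioo fun u hu v hv huv => ?_
  exact (quantile_le_iff hu).2 (huv.trans ((quantile_le_iff hv).1 le_rfl))

theorem isProbabilityMeasure_restrict_Ioo_zero_one :
    IsProbabilityMeasure ((volume : Measure ℝ).restrict (Ioo 0 1)) :=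
  ⟨by simp⟩

theorem map_quantile (μ : Measure ℝ) [IsProbabilityMeasure μ] :
    (volume.restrict (Ioo 0 1)).map (quantile μ) = μ := by
  have := isProbabilityMeasure_restrict_Ioo_zero_one
  have := Measure.isProbabilityMeasure_map (aemeasurable_quantile μ)
  refine Measure.ext_of_Iic _ _ fun t => ?_
  have h₁ : (quantile μ ⁻¹' Iic t) ∩ Ioo 0 1 = Iic (cdf μ t) ∩ Ioo 0 1 := by
    ext u
    simp only [mem_inter_iff, mem_preimage, mem_Iic]
    exact and_congr_left fun hu => quantile_le_iff hu
  rw [Measure.map_apply_of_aemeasurable (aemeasurable_quantile μ) measurableSet_Iic,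
    Measure.restrict_apply' measurableSet_Ioo, h₁, ← ofReal_cdf]
  have h0 := cdf_nonneg μ t
  have h1 := cdf_le_one μ t
  apply le_antisymm
  · calc volume (Iic (cdf μ t) ∩ Ioo 0 1) ≤ volume (Ioc 0 (cdf μ t)) :=
          measure_mono fun u hu => ⟨hu.2.1, hu.1⟩
      _ = _ := by simp
  · calc ENNReal.ofReal (cdf μ t) = volume (Ioo 0 (cdf μ t)) := by simp
      _ ≤ volume (Iic (cdf μ t) ∩ Ioo 0 1) := measure_mono fun u hu => mem_inter hu.2.le ⟨hu.1, hu.2.trans_le h1⟩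

theorem isCoupling_map_quantile (μ ν : Measure ℝ) [IsProbabilityMeasure μ]
    [IsProbabilityMeasure ν] :
    IsCoupling ((volume.restrict (Ioo 0 1)).map fun u => (quantile μ u, quantile ν u)) μ ν := by
  have := isProbabilityMeasure_restrict_Ioo_zero_one
  have h := (aemeasurable_quantile μ).prodMk (aemeasurable_quantile ν)
  refine ⟨Measure.isProbabilityMeasure_map h, ?_, ?_⟩
  · rw [AEMeasurable.map_map_of_aemeasurable (by fun_prop) h]
    exact map_quantile μ
  · rw [AEMeasurable.map_map_of_aemeasurable (by fun_prop) h]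
    exact map_quantile ν

theorem enorm_sub_eq_volume_Ico (a b : ℝ) : ‖a - b‖ₑ = volume (Ico (min a b) (max a b)) := by
  rw [Real.volume_Ico, max_sub_min_eq_abs', Real.enorm_eq_ofReal_abs]

theorem enorm_sub_eq_volume_Ioc (a b : ℝ) : ‖a - b‖ₑ = volume (Ioc (min a b) (max a b)) := by
  rw [Real.volume_Ioc, max_sub_min_eq_abs', Real.enorm_eq_ofReal_abs]

/-- In dimension one, the Wasserstein distance is at most the `L¹` distance of the distribution
functions. -/
theorem ofReal_W1_le_lintegral_cdf (μ ν : Measure ℝ) [IsProbabilityMeasure μ]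
    [IsProbabilityMeasure ν] :
    ENNReal.ofReal (W1 μ ν) ≤ ∫⁻ t, ‖cdf μ t - cdf ν t‖ₑ := by
  have hm := (aemeasurable_quantile μ).prodMk (aemeasurable_quantile ν)
  have hle := (isCoupling_map_quantile μ ν).W1_le
  rw [integral_map hm (Measurable.aestronglyMeasurable (by fun_prop))] at hle
  have mμ : Measurable (cdf μ) := (monotone_cdf μ).measurable
  have mν : Measurable (cdf ν) := (monotone_cdf ν).measurable
  let S : Set (ℝ × ℝ) :=
    {p | p.1 ∈ Ioc (min (cdf μ p.2) (cdf ν p.2)) (max (cdf μ p.2) (cdf ν p.2))}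
  have hS : MeasurableSet S := by
    exact (measurableSet_lt (f := fun p : ℝ × ℝ => min (cdf μ p.2) (cdf ν p.2))
      (by fun_prop) measurable_fst).inter
      (measurableSet_le (g := fun p : ℝ × ℝ => max (cdf μ p.2) (cdf ν p.2))
        measurable_fst (by fun_prop))
  calc ENNReal.ofReal (W1 μ ν)
      ≤ ENNReal.ofReal (∫ u in Ioo 0 1, ‖quantile μ u - quantile ν u‖) :=
        ENNReal.ofReal_le_ofReal hle
    _ ≤ ∫⁻ u in Ioo 0 1, ‖quantile μ u - quantile ν u‖ₑ := by
        by_cases hi : Integrable (fun u => quantile μ u - quantile ν u) (volume.restrict (Ioo 0 1))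
        · rw [ofReal_integral_norm_eq_lintegral_enorm hi]
        · rw [integral_undef]
          · simp
          · rwa [integrable_norm_iff]
            exact ((aemeasurable_quantile μ).sub (aemeasurable_quantile ν)).aestronglyMeasurable
    _ = ∫⁻ u in Ioo 0 1, ∫⁻ t, S.indicator 1 (u, t) := by
        refine setLIntegral_congr_fun measurableSet_Ioo fun u hu => ?_
        have hset : Ico (min (quantile μ u) (quantile ν u)) (max (quantile μ u) (quantile ν u)) =
            Prod.mk u ⁻¹' S := by
          ext t
          simp only [S, mem_Ico, min_le_iff, ← not_le, max_le_iff, quantile_le_iff hu,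
            mem_preimage, mem_ofPred_eq, mem_Ioc, le_max_iff, le_min_iff]
          tauto
        simp only [enorm_sub_eq_volume_Ico, hset]
        rw [← lintegral_indicator_one (hS.preimage measurable_prodMk_left)]
        rfl
    _ = ∫⁻ t, ∫⁻ u in Ioo 0 1, S.indicator 1 (u, t) :=
        lintegral_lintegral_swap (Measurable.aemeasurable (measurable_one.indicator hS))
    _ ≤ ∫⁻ t, ∫⁻ u, S.indicator 1 (u, t) :=
        lintegral_mono fun t => setLIntegral_le_lintegral _ _
    _ = ∫⁻ t, ‖cdf μ t - cdf ν t‖ₑ := by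
        refine lintegral_congr fun t => ?_
        rw [enorm_sub_eq_volume_Ioc, ← lintegral_indicator_one measurableSet_Ioc]
        rfl

end quantile

section empirical

theorem cdf_empMeasure {n : ℕ} (hn : 0 < n) (x : Fin n → ℝ) (t : ℝ) :
    cdf (empMeasure x) t = (n : ℝ)⁻¹ * ∑ i, (Iic t).indicator 1 (x i) := by
  have := isProbabilityMeasure_empMeasure hn x
  rw [cdf_eq_real, ← integral_indicator_one measurableSet_Iic, integral_empMeasure]
  exact stronglyMeasurable_one.indicator measurableSet_Iic

theorem sq_integral_abs_le {Ω : Type*} [MeasurableSpace Ω] {μ : Measure Ω}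
    [IsProbabilityMeasure μ] {X : Ω → ℝ} (hX : MemLp X 2 μ) :
    (∫ ω, |X ω| ∂μ) ^ 2 ≤ ∫ ω, X ω ^ 2 ∂μ := by
  have h := variance_eq_sub hX.abs
  have h0 := variance_nonneg (fun ω => |X ω|) μ
  have e : ∫ ω, |X ω| ^ 2 ∂μ = ∫ ω, X ω ^ 2 ∂μ := by simp only [sq_abs]
  change Var[fun ω => |X ω|; μ] = ∫ ω, |X ω| ^ 2 ∂μ - (∫ ω, |X ω| ∂μ) ^ 2 at h
  linarith

/-- The mean absolute deviation of an average of i.i.d. variables is at most the standard deviation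
divided by `√n`. -/
theorem integral_abs_average_sub_le {Ω : Type*} [MeasurableSpace Ω] (P : Measure Ω)
    [IsProbabilityMeasure P] {f : Ω → ℝ} (hf : MemLp f 2 P) {n : ℕ} (hn : 0 < n) :
    ∫ x, |∫ y, f y ∂P - (n : ℝ)⁻¹ * ∑ i, f (x i)| ∂(Measure.pi fun _ : Fin n => P) ≤
      √(Var[f; P] / n) := by
  have hn' : (n : ℝ) ≠ 0 := by exact_mod_cast hn.ne'
  let Q := Measure.pi fun _ : Fin n => P
  have hmp (i : Fin n) : MeasurePreserving (fun x : Fin n → Ω => x i) Q P :=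
    measurePreserving_eval _ i
  have hL (i : Fin n) : MemLp (fun x : Fin n → Ω => f (x i)) 2 Q :=
    hf.comp_measurePreserving (hmp i)
  have hsum : MemLp (fun x : Fin n → Ω => ∑ i, f (x i)) 2 Q := memLp_finsetSum _ fun i _ => hL i
  have hA : MemLp (fun x : Fin n → Ω => (n : ℝ)⁻¹ * ∑ i, f (x i)) 2 Q := hsum.const_mul _
  have hmean : ∫ x, (n : ℝ)⁻¹ * ∑ i, f (x i) ∂Q = ∫ y, f y ∂P := by
    rw [integral_const_mul, integral_finsetSum _ fun i _ => (hL i).integrable (by norm_num)]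
    have (i : Fin n) : ∫ x, f (x i) ∂Q = ∫ y, f y ∂P := by
      have h := integral_map (μ := Q) (φ := fun x : Fin n → Ω => x i) (f := f)
        (hmp i).aemeasurable (by rw [(hmp i).map_eq]; exact hf.aestronglyMeasurable)
      rw [(hmp i).map_eq] at h
      exact h.symm
    simp [this, hn']
  have hvar : Var[fun x : Fin n → Ω => (n : ℝ)⁻¹ * ∑ i, f (x i); Q] = Var[f; P] / n := by
    rw [variance_const_mul]
    have h := variance_sum_pi (μ := fun _ : Fin n => P) (X := fun _ => f) fun _ => hf
    have e : (∑ i, fun ω : Fin n → Ω => f (ω i)) = fun x => ∑ i, f (x i) := by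
      ext; simp
    rw [e] at h
    rw [h]
    simp
    field_simp
  have hsq := sq_integral_abs_le ((memLp_const (∫ y, f y ∂P)).sub hA)
  refine Real.le_sqrt_of_sq_le ?_
  rw [← hvar, variance_eq_integral hA.aestronglyMeasurable.aemeasurable, hmean]
  refine hsq.trans_eq (integral_congr_ae (.of_forall fun x => ?_))
  simp only [Pi.sub_apply]
  ring

theorem lintegral_enorm_average_sub_le {Ω : Type*} [MeasurableSpace Ω] (P : Measure Ω)
    [IsProbabilityMeasure P] {f : Ω → ℝ} (hf : MemLp f 2 P) {n : ℕ} (hn : 0 < n) :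
    ∫⁻ x, ‖∫ y, f y ∂P - (n : ℝ)⁻¹ * ∑ i, f (x i)‖ₑ ∂(Measure.pi fun _ : Fin n => P) ≤
      ENNReal.ofReal √(Var[f; P] / n) := by
  have hint : Integrable (fun x : Fin n → Ω => ∫ y, f y ∂P - (n : ℝ)⁻¹ * ∑ i, f (x i))
      (Measure.pi fun _ : Fin n => P) := by
    refine (integrable_const _).sub (Integrable.const_mul (integrable_finsetSum _ fun i _ => ?_) _)
    exact (hf.comp_measurePreserving
      (measurePreserving_eval (fun _ : Fin n => P) i)).integrable (by norm_num)
  rw [← ofReal_integral_norm_eq_lintegral_enorm hint]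
  exact ENNReal.ofReal_le_ofReal (integral_abs_average_sub_le P hf hn)

end empirical

section rate

theorem cdf_map_eq_integral {Ω : Type*} [MeasurableSpace Ω] (P : Measure Ω)
    [IsProbabilityMeasure P] {p : Ω → ℝ} (hp : Measurable p) (t : ℝ) :
    cdf (P.map p) t = ∫ y, (Iic t).indicator 1 (p y) ∂P := by
  have := Measure.isProbabilityMeasure_map (μ := P) hp.aemeasurable
  rw [cdf_eq_real, ← integral_indicator_one measurableSet_Iic, integral_map hp.aemeasurable]
  exact (stronglyMeasurable_one.indicator measurableSet_Iic).aestronglyMeasurable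

/-- Expected `L¹` distance between the distribution function of a bounded real random variable and
its empirical distribution function. -/
theorem lintegral_lintegral_cdf_sub_empMeasure_le {Ω : Type*} [MeasurableSpace Ω] (P : Measure Ω)
    [IsProbabilityMeasure P] {p : Ω → ℝ} (hp : Measurable p) {M : ℝ}
    (hM : ∀ᵐ y ∂P, |p y| ≤ M) {n : ℕ} (hn : 0 < n) :
    ∫⁻ x, (∫⁻ t, ‖cdf (P.map p) t - (n : ℝ)⁻¹ * ∑ i, (Iic t).indicator 1 (p (x i))‖ₑ)
      ∂(Measure.pi fun _ : Fin n => P) ≤ ENNReal.ofReal (M * √(n : ℝ)⁻¹) := by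
  have hmeas : Measurable fun q : (Fin n → Ω) × ℝ =>
      ‖cdf (P.map p) q.2 - (n : ℝ)⁻¹ * ∑ i, (Iic q.2).indicator (1 : ℝ → ℝ) (p (q.1 i))‖ₑ := by
    have h₁ : Measurable (cdf (P.map p)) := (monotone_cdf _).measurable
    have h₂ (i : Fin n) : Measurable fun q : (Fin n → Ω) × ℝ =>
        (Iic q.2).indicator (1 : ℝ → ℝ) (p (q.1 i)) := by
      have hs : MeasurableSet {q : (Fin n → Ω) × ℝ | p (q.1 i) ≤ q.2} :=
        measurableSet_le (by fun_prop) (by fun_prop)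
      exact measurable_one.indicator hs
    fun_prop
  rw [lintegral_lintegral_swap hmeas.aemeasurable]
  have hbound (t : ℝ) :
      ∫⁻ x, ‖cdf (P.map p) t - (n : ℝ)⁻¹ * ∑ i, (Iic t).indicator 1 (p (x i))‖ₑ
        ∂(Measure.pi fun _ : Fin n => P) ≤
      (Ico (-M) M).indicator (fun _ => ENNReal.ofReal (2⁻¹ * √(n : ℝ)⁻¹)) t := by
    let f : Ω → ℝ := fun y => (Iic t).indicator 1 (p y)
    have hf : Measurable f := (measurable_one.indicator measurableSet_Iic).comp hp
    have hf01 (y : Ω) : f y ∈ Icc (0 : ℝ) 1 := by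
      by_cases h : p y ≤ t <;> simp [f, h]
    have hfL : MemLp f 2 P := memLp_of_bounded (.of_forall hf01) hf.aestronglyMeasurable 2
    rw [cdf_map_eq_integral P hp t]
    refine (lintegral_enorm_average_sub_le P hfL hn).trans ?_
    by_cases ht : t ∈ Ico (-M) M
    · rw [indicator_of_mem ht]
      have hv := variance_le_sq_of_bounded (μ := P) (.of_forall hf01) hf.aemeasurable
      refine ENNReal.ofReal_le_ofReal ?_
      rw [div_eq_mul_inv, Real.sqrt_mul (variance_nonneg _ _)]
      gcongr
      exact (Real.sqrt_le_left (by norm_num)).2 (hv.trans_eq (by norm_num))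
    · have hconst : ∃ c : ℝ, f =ᵐ[P] fun _ => c := by
        rcases not_and_or.1 ht with h | h
        · refine ⟨0, hM.mono fun y hy => ?_⟩
          have : ¬ p y ≤ t := fun h' => h ((abs_le.1 hy).1.trans h')
          simp [f, this]
        · refine ⟨1, hM.mono fun y hy => ?_⟩
          have : p y ≤ t := (abs_le.1 hy).2.trans (not_lt.1 h)
          simp [f, this]
      obtain ⟨c, hc⟩ := hconst
      rw [variance_congr hc, variance_eq_integral aemeasurable_const]
      simp
  refine (lintegral_mono hbound).trans_eq ?_
  rw [lintegral_indicator measurableSet_Ico, setLIntegral_const, Real.volume_Ico,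
    ← ENNReal.ofReal_mul (by positivity)]
  congr 1
  ring

end rate

section MPW

variable {d : ℕ}

theorem FiniteFirstMoment.map_apply {μ : Measure (EuclideanSpace ℝ (Fin d))}
    (h : FiniteFirstMoment μ) (j : Fin d) : FiniteFirstMoment (μ.map fun x => x j) := by
  rw [FiniteFirstMoment, HasFiniteIntegral, lintegral_map (by fun_prop) (by fun_prop)]
  refine lt_of_le_of_lt (lintegral_mono fun x => ?_) h
  simp only [enorm_norm]
  exact enorm_le_iff_norm_le.2 (PiLp.norm_apply_le x j)

theorem finiteFirstMoment_of_ae_norm_le {E : Type*} [MeasurableSpace E] [NormedAddCommGroup E]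
    {μ : Measure E} [IsFiniteMeasure μ] {M : ℝ} (h : ∀ᵐ x ∂μ, ‖x‖ ≤ M) : FiniteFirstMoment μ :=
  HasFiniteIntegral.of_bounded (C := M) (by simpa using h)

theorem MPW_nonneg {lam : Fin d → ℝ} (hlam : ∀ j, 0 ≤ lam j)
    (μ ν : Measure (EuclideanSpace ℝ (Fin d))) : 0 ≤ MPW lam μ ν :=
  add_nonneg (W1_nonneg _ _) (Finset.sum_nonneg fun j _ => mul_nonneg (hlam j) (W1_nonneg _ _))

theorem mul_W1_map_le_MPW {lam : Fin d → ℝ} (hlam : ∀ j, 0 ≤ lam j)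
    (μ ν : Measure (EuclideanSpace ℝ (Fin d))) (j : Fin d) :
    lam j * W1 (μ.map fun x => x j) (ν.map fun x => x j) ≤ MPW lam μ ν := by
  refine le_add_of_nonneg_of_le (W1_nonneg _ _) ?_
  exact Finset.single_le_sum
    (f := fun j => lam j * W1 (μ.map fun x => x j) (ν.map fun x => x j))
    (fun i _ => mul_nonneg (hlam i) (W1_nonneg _ _)) (Finset.mem_univ j)

theorem MPW_empMeasure_le_add {lam : Fin d → ℝ} (hlam : ∀ j, 0 ≤ lam j) {n : ℕ} (hn : 0 < n)
    {ν : Measure (EuclideanSpace ℝ (Fin d))} [IsProbabilityMeasure ν] (hν : FiniteFirstMoment ν)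
    (x y : Fin n → EuclideanSpace ℝ (Fin d)) :
    MPW lam (empMeasure x) ν ≤ MPW lam (empMeasure y) ν + (1 + ∑ j, lam j) * dist x y := by
  have hxy (i : Fin n) : ‖x i - y i‖ ≤ dist x y := by
    rw [← dist_eq_norm]; exact dist_le_pi_dist x y i
  have := isProbabilityMeasure_empMeasure hn x
  have := isProbabilityMeasure_empMeasure hn y
  have h₀ : W1 (empMeasure x) ν ≤ dist x y + W1 (empMeasure y) ν :=
    (W1_triangle (finiteFirstMoment_empMeasure hn x) (finiteFirstMoment_empMeasure hn y) hν).trans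
      (add_le_add_left (W1_empMeasure_le_of_forall_norm_sub_le hn hxy) _)
  have h₁ (j : Fin d) : W1 ((empMeasure x).map fun z => z j) (ν.map fun z => z j) ≤
      dist x y + W1 ((empMeasure y).map fun z => z j) (ν.map fun z => z j) := by
    have hm : Measurable fun z : EuclideanSpace ℝ (Fin d) => z j := by fun_prop
    have := Measure.isProbabilityMeasure_map (μ := ν) hm.aemeasurable
    rw [map_empMeasure _ hm, map_empMeasure _ hm]
    have := isProbabilityMeasure_empMeasure hn fun i => x i j
    have := isProbabilityMeasure_empMeasure hn fun i => y i j
    refine (W1_triangle (finiteFirstMoment_empMeasure hn _)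
      (finiteFirstMoment_empMeasure hn fun i => y i j)
      (hν.map_apply j)).trans ?_
    gcongr
    exact W1_empMeasure_le_of_forall_norm_sub_le hn fun i =>
      (PiLp.norm_apply_le (x i - y i) j).trans (hxy i)
  have h₂ := Finset.sum_le_sum fun j (_ : j ∈ Finset.univ) => mul_le_mul_of_nonneg_left (h₁ j) (hlam j)
  simp only [mul_add, Finset.sum_add_distrib, ← Finset.sum_mul] at h₂
  unfold MPW
  linarith

theorem lipschitzWith_iInf_MPW_empMeasure {lam : Fin d → ℝ} (hlam : ∀ j, 0 ≤ lam j) {n : ℕ}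
    (hn : 0 < n) {Θ : Type*} [Nonempty Θ] {Pθ : Θ → Measure (EuclideanSpace ℝ (Fin d))}
    (hP : ∀ θ, IsProbabilityMeasure (Pθ θ)) (hfin : ∀ θ, FiniteFirstMoment (Pθ θ)) :
    LipschitzWith (1 + ∑ j, lam j).toNNReal
      fun x : Fin n → EuclideanSpace ℝ (Fin d) => ⨅ θ, MPW lam (empMeasure x) (Pθ θ) := by
  refine LipschitzWith.of_le_add_mul' _ fun x y => ?_
  rw [← sub_le_iff_le_add]
  refine le_ciInf fun θ => ?_
  rw [sub_le_iff_le_add]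
  refine (ciInf_le ⟨0, ?_⟩ θ).trans (MPW_empMeasure_le_add hlam hn (hfin θ) x y)
  rintro _ ⟨θ, rfl⟩
  exact MPW_nonneg hlam _ _

theorem integrable_pi_of_lipschitzWith {E : Type*} [NormedAddCommGroup E] [MeasurableSpace E]
    [BorelSpace E] [SecondCountableTopology E] {P : Measure E} [IsProbabilityMeasure P] {M : ℝ}
    (hM : ∀ᵐ y ∂P, ‖y‖ ≤ M) {n : ℕ} {K : NNReal} {f : (Fin n → E) → ℝ} (hf : LipschitzWith K f) :
    Integrable f (Measure.pi fun _ : Fin n => P) := by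
  have hx : ∀ᵐ x ∂(Measure.pi fun _ : Fin n => P), ∀ i, ‖x i‖ ≤ M :=
    ae_all_iff.2 fun i => (Measure.quasiMeasurePreserving_eval (fun _ : Fin n => P) i).ae hM
  refine Integrable.of_bound hf.continuous.aestronglyMeasurable (‖f 0‖ + K * max M 0) ?_
  filter_upwards [hx] with x hx
  have h₁ : ‖x‖ ≤ max M 0 :=
    (pi_norm_le_iff_of_nonneg (le_max_right _ _)).2 fun i => (hx i).trans (le_max_left _ _)
  have h₂ := hf.dist_le_mul x 0
  rw [dist_zero_right, dist_eq_norm] at h₂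
  have h₃ := norm_le_norm_add_norm_sub' (f x) (f 0)
  have h₄ : K * ‖x‖ ≤ K * max M 0 := by gcongr
  linarith

end MPW

/-- Convergence rate of the POTNet generative distribution in each
marginal 1-Wasserstein distance: if `θ̂` is a minimizer of `θ ↦ D(P̂ⁿ, P_θ)` (a.s.)
with positive weights `λ_j`, then for each `j`,
`E[W₁((p_j)_* P_X, (p_j)_* P_θ̂)] ≤ λ_j⁻¹ E[inf_θ D(P̂ⁿ, P_θ)] + C n^{-1/2}` for a
constant `C` depending only on `M`. -/
theorem potnet_marginal_convergence_rate (M : ℝ) (hM : 0 < M) :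
    ∃ C : ℝ, 0 < C ∧ ∀ (d n : ℕ), 0 < d → 0 < n →
      ∀ (lam : Fin d → ℝ), (∀ j, 0 < lam j) →
      ∀ (Θ : Type) (_ : Nonempty Θ)
        (Pθ : Θ → Measure (EuclideanSpace ℝ (Fin d))),
        (∀ θ, IsProbabilityMeasure (Pθ θ)) →
        (∀ θ, FiniteFirstMoment (Pθ θ)) →
      ∀ (P : Measure (EuclideanSpace ℝ (Fin d))) [IsProbabilityMeasure P],
        P (Metric.closedBall 0 M)ᶜ = 0 →
      ∀ (θhat : (Fin n → EuclideanSpace ℝ (Fin d)) → Θ),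
        (∀ᵐ x ∂(Measure.pi fun _ : Fin n => P),
          MPW lam (empMeasure x) (Pθ (θhat x)) =
            ⨅ θ : Θ, MPW lam (empMeasure x) (Pθ θ)) →
        ∀ j : Fin d,
          (∫ x, W1 (P.map (fun y => y j)) ((Pθ (θhat x)).map (fun y => y j))
              ∂(Measure.pi fun _ : Fin n => P)) ≤
            (lam j)⁻¹ *
              (∫ x, (⨅ θ : Θ, MPW lam (empMeasure x) (Pθ θ))
                ∂(Measure.pi fun _ : Fin n => P)) +
              C * (n : ℝ) ^ (-(1 : ℝ) / 2) := by
  refine ⟨M, hM, fun d n _ hn lam hlam Θ _ Pθ hP hfin P _ hPM θhat hθ j => ?_⟩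
  have hlam' : ∀ j, 0 ≤ lam j := fun j => (hlam j).le
  have hbd : ∀ᵐ y ∂P, ‖y‖ ≤ M := by
    filter_upwards [measure_eq_zero_iff_ae_notMem.1 hPM] with y hy
    simpa using hy
  have hm : Measurable fun y : EuclideanSpace ℝ (Fin d) => y j := by fun_prop
  let Q := Measure.pi fun _ : Fin n => P
  let I : (Fin n → EuclideanSpace ℝ (Fin d)) → ℝ := fun x => ⨅ θ, MPW lam (empMeasure x) (Pθ θ)
  have hI : Integrable I Q :=
    integrable_pi_of_lipschitzWith hbd (lipschitzWith_iInf_MPW_empMeasure hlam' hn hP hfin)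
  let G : (Fin n → EuclideanSpace ℝ (Fin d)) → ℝ≥0∞ := fun x =>
    ∫⁻ t, ‖cdf (P.map fun y => y j) t - cdf (empMeasure fun i => x i j) t‖ₑ
  have hG_meas : Measurable G := by
    have h₁ : Measurable (cdf (P.map fun y => y j)) := (monotone_cdf _).measurable
    have h₂ (i : Fin n) : Measurable fun q : (Fin n → EuclideanSpace ℝ (Fin d)) × ℝ =>
        (Iic q.2).indicator (1 : ℝ → ℝ) (q.1 i j) := by
      have hs : MeasurableSet {q : (Fin n → EuclideanSpace ℝ (Fin d)) × ℝ | q.1 i j ≤ q.2} :=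
        measurableSet_le (by fun_prop) (by fun_prop)
      exact measurable_one.indicator hs
    simp only [G, cdf_empMeasure hn]
    refine Measurable.lintegral_prod_right ?_
    fun_prop
  have hG_le : ∫⁻ x, G x ∂Q ≤ ENNReal.ofReal (M * √(n : ℝ)⁻¹) := by
    simp only [G, cdf_empMeasure hn]
    exact lintegral_lintegral_cdf_sub_empMeasure_le P hm
      (hbd.mono fun y hy => (PiLp.norm_apply_le y j).trans hy) hn
  have hG_fin : ∫⁻ x, G x ∂Q ≠ ∞ := ne_top_of_le_ne_top ENNReal.ofReal_ne_top hG_le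
  have hG_ae : ∀ᵐ x ∂Q, G x < ∞ := ae_lt_top hG_meas hG_fin
  have hG_int : Integrable (fun x => (G x).toReal) Q :=
    integrable_toReal_of_lintegral_ne_top hG_meas.aemeasurable hG_fin
  have hG_bound : ∫ x, (G x).toReal ∂Q ≤ M * (n : ℝ) ^ (-(1 : ℝ) / 2) := by
    rw [integral_toReal hG_meas.aemeasurable hG_ae, neg_div, Real.rpow_neg (by positivity),
      ← Real.sqrt_eq_rpow, ← Real.sqrt_inv]
    exact ENNReal.toReal_le_of_le_ofReal (by positivity) hG_le
  have hpoint : ∀ᵐ x ∂Q, W1 (P.map fun y => y j) ((Pθ (θhat x)).map fun y => y j) ≤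
      (lam j)⁻¹ * I x + (G x).toReal := by
    filter_upwards [hθ, hG_ae] with x hx hGx
    have := Measure.isProbabilityMeasure_map (μ := P) hm.aemeasurable
    have := hP (θhat x)
    have := Measure.isProbabilityMeasure_map (μ := Pθ (θhat x)) hm.aemeasurable
    have := isProbabilityMeasure_empMeasure hn fun i => x i j
    have h₁ := W1_triangle ((finiteFirstMoment_of_ae_norm_le hbd).map_apply j)
      (finiteFirstMoment_empMeasure hn fun i => x i j) ((hfin (θhat x)).map_apply j)
    have h₂ : W1 (P.map fun y => y j) (empMeasure fun i => x i j) ≤ (G x).toReal :=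
      (ENNReal.ofReal_le_iff_le_toReal hGx.ne).1 (ofReal_W1_le_lintegral_cdf _ _)
    have h₃ := mul_W1_map_le_MPW hlam' (empMeasure x) (Pθ (θhat x)) j
    rw [hx, map_empMeasure x hm, ← le_inv_mul_iff₀ (hlam j)] at h₃
    linarith
  calc ∫ x, W1 (P.map fun y => y j) ((Pθ (θhat x)).map fun y => y j) ∂Q
      ≤ ∫ x, ((lam j)⁻¹ * I x + (G x).toReal) ∂Q :=
        integral_mono_of_nonneg (.of_forall fun _ => W1_nonneg _ _)
          ((hI.const_mul _).add hG_int) hpoint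
    _ = (lam j)⁻¹ * ∫ x, I x ∂Q + ∫ x, (G x).toReal ∂Q := by
        rw [integral_add (hI.const_mul _) hG_int, integral_const_mul]
    _ ≤ _ := by gcongr
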